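/- arXiv:math/0605710 — 6 statements merged into one kernel-verified Lean document; each statement's English description precedes it below -/
import Mathlib

section
/- Let X ∈ V be nonzero and θ ∈ V* with θ(X) = 1. Define the T-duality map M : V ⊕ V* → V ⊕ V* by M(x ⊕ ξ) = (x − θ(x)X + ξ(X)X) ⊕ (ξ − ξ(X)θ + θ(x)θ). Then: (i) M is a linear q-isometry with M ∘ M = id; (ii) for every subspace L ⊆ V of dimension k and every alternating F : V → V*, the image M(W_{L,F}) is again maximally isotropic, hence of the form W_{L^⊤,F^⊤} for a unique subspace L^⊤ ⊆ V and some alternating F^⊤ : V → V*; and the dimension of L^⊤ (i.e. n minus the rank dim(M(W_{L,F}) ∩ ({0} ⊕ V*)) of the annihilator part) is given by: dim L^⊤ = k − 1 if X ∈ L, and dim L^⊤ = k + 1 if X ∉ L. -/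
noncomputable section

variable {V : Type*} [AddCommGroup V] [Module ℝ V] [FiniteDimensional ℝ V]

/-- The natural symmetric bilinear pairing `q(x ⊕ ξ, y ⊕ η) = (ξ(y) + η(x))/2` of signature
`(n, n)` on `V ⊕ V*`. -/
def gq (p p' : V × Module.Dual ℝ V) : ℝ := (p.2 p'.1 + p'.2 p.1) / 2

/-- A linear map `V → V*` is alternating if `F(x)(x) = 0` for all `x`; equivalently, it is a
2-form. -/
def IsAltMap (F : V →ₗ[ℝ] Module.Dual ℝ V) : Prop := ∀ x, F x x = 0

/-- The shear `x ⊕ ξ ↦ x ⊕ (F(x) + ξ)` of `V ⊕ V*` determined by `F : V → V*` (for alternating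
`F` this is the `B`-field transformation `e_F`). -/
def shear (F : V →ₗ[ℝ] Module.Dual ℝ V) :
    (V × Module.Dual ℝ V) →ₗ[ℝ] (V × Module.Dual ℝ V) :=
  (LinearMap.fst ℝ V (Module.Dual ℝ V)).prod
    (F ∘ₗ LinearMap.fst ℝ V (Module.Dual ℝ V) + LinearMap.snd ℝ V (Module.Dual ℝ V))

/-- The subspace `W_{L,F} = {x ⊕ (F(x) + ξ) : x ∈ L, ξ ∈ Ann L}` of `V ⊕ V*` attached to a
subspace `L ⊆ V` and an alternating map `F : V → V*`. -/
def WLF (L : Submodule ℝ V) (F : V →ₗ[ℝ] Module.Dual ℝ V) :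
    Submodule ℝ (V × Module.Dual ℝ V) :=
  (L.prod L.dualAnnihilator).map (shear F)

/-- A subspace `W ⊆ V ⊕ V*` is maximally isotropic if it has dimension `n = dim V` and the
pairing `q` vanishes identically on it. -/
def MaxIsotropic (W : Submodule ℝ (V × Module.Dual ℝ V)) : Prop :=
  Module.finrank ℝ W = Module.finrank ℝ V ∧ ∀ p ∈ W, ∀ p' ∈ W, gq p p' = 0

/-- The T-duality map `M(x ⊕ ξ) = (x − θ(x)X + ξ(X)X) ⊕ (ξ − ξ(X)θ + θ(x)θ)` on `V ⊕ V*`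
determined by a vector `X ∈ V` and a covector `θ ∈ V*`. -/
def Tdual (X : V) (θ : Module.Dual ℝ V) :
    (V × Module.Dual ℝ V) →ₗ[ℝ] (V × Module.Dual ℝ V) :=
  (LinearMap.fst ℝ V (Module.Dual ℝ V) -
      (θ ∘ₗ LinearMap.fst ℝ V (Module.Dual ℝ V)).smulRight X +
      ((Module.Dual.eval ℝ V X) ∘ₗ LinearMap.snd ℝ V (Module.Dual ℝ V)).smulRight X).prod
    (LinearMap.snd ℝ V (Module.Dual ℝ V) -
      ((Module.Dual.eval ℝ V X) ∘ₗ LinearMap.snd ℝ V (Module.Dual ℝ V)).smulRight θ +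
      (θ ∘ₗ LinearMap.fst ℝ V (Module.Dual ℝ V)).smulRight θ)

theorem Tdual_fst (X : V) (θ : Module.Dual ℝ V) (p : V × Module.Dual ℝ V) :
    (Tdual X θ p).1 = p.1 - θ p.1 • X + p.2 X • X := by
  simp [Tdual]

theorem Tdual_snd (X : V) (θ : Module.Dual ℝ V) (p : V × Module.Dual ℝ V) :
    (Tdual X θ p).2 = p.2 - p.2 X • θ + θ p.1 • θ := by
  simp [Tdual]

theorem Tdual_invol (X : V) (θ : Module.Dual ℝ V) (hθ : θ X = 1) (p : V × Module.Dual ℝ V) :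
    Tdual X θ (Tdual X θ p) = p := by
  apply Prod.ext
  · simp only [Tdual_fst, Tdual_snd, map_add, map_sub, map_smul, hθ, LinearMap.add_apply,
      LinearMap.sub_apply, LinearMap.smul_apply, smul_eq_mul]
    module
  · simp only [Tdual_fst, Tdual_snd, map_add, map_sub, map_smul, hθ, LinearMap.add_apply,
      LinearMap.sub_apply, LinearMap.smul_apply, smul_eq_mul]
    module

theorem Tdual_gq (X : V) (θ : Module.Dual ℝ V) (hθ : θ X = 1) (p p' : V × Module.Dual ℝ V) :
    gq (Tdual X θ p) (Tdual X θ p') = gq p p' := by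
  simp only [gq, Tdual_fst, Tdual_snd, map_add, map_sub, map_smul, hθ, LinearMap.add_apply,
      LinearMap.sub_apply, LinearMap.smul_apply, smul_eq_mul]
  ring

theorem mem_WLF (L : Submodule ℝ V) (F : V →ₗ[ℝ] Module.Dual ℝ V) (p : V × Module.Dual ℝ V) :
    p ∈ WLF L F ↔ p.1 ∈ L ∧ ∀ y ∈ L, p.2 y = F p.1 y := by
  unfold WLF
  rw [Submodule.mem_map]
  constructor
  · rintro ⟨⟨x, ξ⟩, ⟨hx, hξ⟩, rfl⟩
    refine ⟨hx, fun y hy => ?_⟩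
    have := (Submodule.mem_dualAnnihilator ξ).1 hξ y hy
    simp [shear, this]
  · rintro ⟨h1, h2⟩
    refine ⟨(p.1, p.2 - F p.1), ⟨h1, ?_⟩, ?_⟩
    · refine (Submodule.mem_dualAnnihilator _).2 fun y hy => ?_
      simp [h2 y hy]
    · simp [shear]

theorem IsAltMap.swap {F : V →ₗ[ℝ] Module.Dual ℝ V} (hF : IsAltMap F) (x y : V) :
    F x y = - F y x := by
  have := hF (x + y)
  simp only [map_add, LinearMap.add_apply, hF x, hF y] at this
  linarith

theorem WLF_inf (L : Submodule ℝ V) (F : V →ₗ[ℝ] Module.Dual ℝ V) :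
    WLF L F ⊓ Submodule.prod (⊥ : Submodule ℝ V) (⊤ : Submodule ℝ (Module.Dual ℝ V)) =
      L.dualAnnihilator.map (LinearMap.inr ℝ V (Module.Dual ℝ V)) := by
  ext ⟨x, ξ⟩
  simp only [Submodule.mem_inf, mem_WLF, Submodule.mem_prod, Submodule.mem_bot, Submodule.mem_top,
    Submodule.mem_map, Submodule.mem_dualAnnihilator, LinearMap.inr_apply, Prod.mk.injEq]
  constructor
  · rintro ⟨⟨_, h⟩, rfl, _⟩
    exact ⟨ξ, fun y hy => by simpa using h y hy, rfl, rfl⟩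
  · rintro ⟨η, h, rfl, rfl⟩
    exact ⟨⟨L.zero_mem, fun y hy => by simpa using h y hy⟩, rfl, trivial⟩

theorem finrank_map_inj {A B : Type*} [AddCommGroup A] [Module ℝ A] [AddCommGroup B] [Module ℝ B]
    {f : A →ₗ[ℝ] B} (hf : Function.Injective f) (p : Submodule ℝ A) :
    Module.finrank ℝ (p.map f) = Module.finrank ℝ p :=
  (Submodule.equivMapOfInjective f hf p).finrank_eq.symm

theorem finrank_WLF (L : Submodule ℝ V) (F : V →ₗ[ℝ] Module.Dual ℝ V) :
    Module.finrank ℝ (WLF L F) = Module.finrank ℝ V := by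
  have hinj : Function.Injective (shear F) := by
    rintro ⟨x, ξ⟩ ⟨y, η⟩ h
    have h1 : x = y := congrArg Prod.fst h
    have h2 : F x + ξ = F y + η := congrArg Prod.snd h
    subst h1
    rw [add_left_cancel h2]
  let e : L.prod L.dualAnnihilator ≃ₗ[ℝ] L × L.dualAnnihilator :=
    { toFun := fun p => (⟨p.1.1, p.2.1⟩, ⟨p.1.2, p.2.2⟩)
      invFun := fun p => ⟨(p.1.1, p.2.1), ⟨p.1.2, p.2.2⟩⟩
      map_add' := fun _ _ => rfl
      map_smul' := fun _ _ => rfl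
      left_inv := fun _ => rfl
      right_inv := fun _ => rfl }
  haveI : Module.Free ℝ L.dualAnnihilator :=
    Module.Free.of_divisionRing ℝ (L.dualAnnihilator : Submodule ℝ (Module.Dual ℝ V))
  unfold WLF
  rw [finrank_map_inj hinj,
    LinearEquiv.finrank_eq e, Module.finrank_prod]
  exact Subspace.finrank_add_finrank_dualAnnihilator_eq L

theorem WLF_maxIsotropic (L : Submodule ℝ V) (F : V →ₗ[ℝ] Module.Dual ℝ V) (hF : IsAltMap F) :
    MaxIsotropic (WLF L F) := by
  refine ⟨finrank_WLF L F, fun p hp p' hp' => ?_⟩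
  rw [mem_WLF] at hp hp'
  rw [gq, hp.2 _ hp'.1, hp'.2 _ hp.1, hF.swap]
  simp

theorem WLF_fst (L : Submodule ℝ V) (F : V →ₗ[ℝ] Module.Dual ℝ V) :
    (WLF L F).map (LinearMap.fst ℝ V (Module.Dual ℝ V)) = L := by
  ext x
  simp only [Submodule.mem_map, mem_WLF]
  constructor
  · rintro ⟨p, ⟨h, _⟩, rfl⟩
    exact h
  · intro h
    exact ⟨(x, F x), ⟨h, fun _ _ => rfl⟩, rfl⟩

theorem MaxIsotropic.exists_WLF {W : Submodule ℝ (V × Module.Dual ℝ V)} (hW : MaxIsotropic W) :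
    ∃ F : V →ₗ[ℝ] Module.Dual ℝ V, IsAltMap F ∧
      W = WLF (W.map (LinearMap.fst ℝ V (Module.Dual ℝ V))) F := by
  set L := W.map (LinearMap.fst ℝ V (Module.Dual ℝ V)) with hL
  let f : W →ₗ[ℝ] L := (LinearMap.fst ℝ V (Module.Dual ℝ V)).submoduleMap W
  have hf : LinearMap.range f = ⊤ :=
    LinearMap.range_eq_top.2 (LinearMap.submoduleMap_surjective _ W)
  obtain ⟨s, hs⟩ := f.exists_rightInverse_of_surjective hf
  have hs1 : ∀ x : L, (s x : V × Module.Dual ℝ V).1 = x := fun x =>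
    congrArg Subtype.val (LinearMap.congr_fun hs x)
  obtain ⟨π, hπ⟩ := L.subtype.exists_leftInverse_of_injective (by simp)
  have hπ1 : ∀ x : L, π x = x := fun x => LinearMap.congr_fun hπ x
  let G : L →ₗ[ℝ] Module.Dual ℝ V := LinearMap.snd ℝ V (Module.Dual ℝ V) ∘ₗ W.subtype ∘ₗ s
  let F : V →ₗ[ℝ] Module.Dual ℝ V := (Module.Dual.transpose (L.subtype ∘ₗ π)) ∘ₗ G ∘ₗ π
  have hF : ∀ x y, F x y = (s (π x) : V × Module.Dual ℝ V).2 (π y : V) := fun x y => rfl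
  refine ⟨F, fun x => ?_, ?_⟩
  · have := hW.2 _ (s (π x)).2 _ (s (π x)).2
    rw [gq, hs1] at this
    rw [hF]
    linarith
  · apply Submodule.eq_of_le_of_finrank_eq
    · intro p hp
      rw [mem_WLF]
      have hpL : p.1 ∈ L := ⟨p, hp, rfl⟩
      refine ⟨hpL, fun y hy => ?_⟩
      have h1 := hW.2 _ hp _ (s ⟨y, hy⟩).2
      have h2 := hW.2 _ (s ⟨p.1, hpL⟩).2 _ (s ⟨y, hy⟩).2
      have e1 := hπ1 ⟨p.1, hpL⟩
      have e2 := hπ1 ⟨y, hy⟩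
      simp only at e1 e2
      rw [hF, e1, e2]
      simp only [gq, hs1] at h1 h2
      linarith
    · rw [finrank_WLF, hW.1]

theorem Tdual_finrank_succ (X : V) (θ : Module.Dual ℝ V)
    (L : Submodule ℝ V) (F : V →ₗ[ℝ] Module.Dual ℝ V) (hXL : X ∉ L) :
    Module.finrank ℝ (((WLF L F).map (Tdual X θ)).map (LinearMap.fst ℝ V (Module.Dual ℝ V))) =
      Module.finrank ℝ L + 1 := by
  have key : ((WLF L F).map (Tdual X θ)).map (LinearMap.fst ℝ V (Module.Dual ℝ V)) =
      L ⊔ Submodule.span ℝ {X} := by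
    apply le_antisymm
    · rintro _ ⟨_, ⟨p, hp, rfl⟩, rfl⟩
      have hp1 := ((mem_WLF L F p).1 hp).1
      rw [LinearMap.fst_apply, Tdual_fst]
      have hX : X ∈ L ⊔ Submodule.span ℝ {X} :=
        Submodule.mem_sup_right (Submodule.mem_span_singleton_self X)
      exact Submodule.add_mem _ (Submodule.sub_mem _ (Submodule.mem_sup_left hp1)
        (Submodule.smul_mem _ _ hX)) (Submodule.smul_mem _ _ hX)
    · obtain ⟨ξ, hξX, hξ⟩ := Submodule.exists_le_ker_of_notMem hXL
      have hX : X ∈ ((WLF L F).map (Tdual X θ)).map (LinearMap.fst ℝ V (Module.Dual ℝ V)) := by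
        have h : (0, ξ) ∈ WLF L F := (mem_WLF _ _ _).2 ⟨L.zero_mem, fun y hy => by
          simpa using hξ hy⟩
        have h2 : ξ X • X ∈
            ((WLF L F).map (Tdual X θ)).map (LinearMap.fst ℝ V (Module.Dual ℝ V)) :=
          ⟨_, ⟨_, h, rfl⟩, by simp [Tdual_fst]⟩
        exact (Submodule.smul_mem_iff _ hξX).1 h2
      refine sup_le (fun x hx => ?_) ((Submodule.span_singleton_le_iff_mem _ _).2 hX)
      have h : (x, F x) ∈ WLF L F := (mem_WLF _ _ _).2 ⟨hx, fun _ _ => rfl⟩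
      have h2 : x - θ x • X + F x X • X ∈
          ((WLF L F).map (Tdual X θ)).map (LinearMap.fst ℝ V (Module.Dual ℝ V)) :=
        ⟨_, ⟨_, h, rfl⟩, by simp [Tdual_fst]⟩
      have h3 := Submodule.add_mem _ h2 (Submodule.smul_mem _ (θ x - F x X) hX)
      convert h3 using 1
      module
  rw [key]
  exact Submodule.finrank_sup_span_singleton hXL

/-- T-duality along `X` (with `θ(X) = 1`): the map `M = Tdual X θ` is an
involutive `q`-isometry, and it maps each maximally isotropic subspace `W_{L,F}` to a maximally
isotropic subspace, hence one of the form `W_{L⊤,F⊤}` with `L⊤` unique; the dimension of `L⊤`,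
which equals `n` minus the rank `dim (M(W_{L,F}) ∩ ({0} ⊕ V*))`, drops by one if `X ∈ L` and
increases by one if `X ∉ L`. -/
theorem tdual_isometry_and_rank (X : V) (hX : X ≠ 0) (θ : Module.Dual ℝ V) (hθ : θ X = 1) :
    (∀ p, Tdual X θ (Tdual X θ p) = p) ∧
    (∀ p p', gq (Tdual X θ p) (Tdual X θ p') = gq p p') ∧
    (∀ (L : Submodule ℝ V) (F : V →ₗ[ℝ] Module.Dual ℝ V), IsAltMap F →
      MaxIsotropic ((WLF L F).map (Tdual X θ)) ∧
      ∃ (L' : Submodule ℝ V) (F' : V →ₗ[ℝ] Module.Dual ℝ V), IsAltMap F' ∧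
        (WLF L F).map (Tdual X θ) = WLF L' F' ∧
        (∀ (L'' : Submodule ℝ V) (F'' : V →ₗ[ℝ] Module.Dual ℝ V), IsAltMap F'' →
          (WLF L F).map (Tdual X θ) = WLF L'' F'' → L'' = L') ∧
        Module.finrank ℝ L' =
          Module.finrank ℝ V -
            Module.finrank ℝ
              ↥((WLF L F).map (Tdual X θ) ⊓
                Submodule.prod (⊥ : Submodule ℝ V) (⊤ : Submodule ℝ (Module.Dual ℝ V))) ∧
        (X ∈ L → Module.finrank ℝ L' = Module.finrank ℝ L - 1) ∧
        (X ∉ L → Module.finrank ℝ L' = Module.finrank ℝ L + 1)) := by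
  refine ⟨Tdual_invol X θ hθ, Tdual_gq X θ hθ, fun L F hF => ?_⟩
  have hinj : Function.Injective (Tdual X θ) :=
    Function.LeftInverse.injective (Tdual_invol X θ hθ)
  have hMI : MaxIsotropic ((WLF L F).map (Tdual X θ)) := by
    refine ⟨?_, ?_⟩
    · rw [finrank_map_inj hinj, finrank_WLF]
    · rintro _ ⟨p, hp, rfl⟩ _ ⟨p', hp', rfl⟩
      rw [Tdual_gq X θ hθ]
      exact (WLF_maxIsotropic L F hF).2 p hp p' hp'
  obtain ⟨F', hF', hW⟩ := hMI.exists_WLF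
  refine ⟨hMI, _, F', hF', hW, ?_, ?_, ?_, Tdual_finrank_succ X θ L F⟩
  · intro L'' F'' _ h
    rw [h, WLF_fst]
  · generalize ((WLF L F).map (Tdual X θ)).map (LinearMap.fst ℝ V (Module.Dual ℝ V)) = L' at hW
    rw [hW, WLF_inf, finrank_map_inj LinearMap.inr_injective]
    have := Subspace.finrank_add_finrank_dualAnnihilator_eq L'
    omega
  · intro hXL
    have hXL' : X ∉ ((WLF L F).map (Tdual X θ)).map (LinearMap.fst ℝ V (Module.Dual ℝ V)) := by
      rintro ⟨_, ⟨p, hp, rfl⟩, h⟩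
      obtain ⟨_, h2⟩ := (mem_WLF L F p).1 hp
      rw [LinearMap.fst_apply, Tdual_fst, h2 X hXL] at h
      have h3 : p.1 = (1 + θ p.1 - F p.1 X) • X := by
        have h0 : p.1 = (p.1 - θ p.1 • X + F p.1 X • X) + (θ p.1 - F p.1 X) • X := by module
        rw [h] at h0
        exact h0.trans (by module)
      have h4 : F p.1 X = 0 := by
        rw [h3]
        simp [hF X]
      rw [h4] at h3
      have h5 := congrArg θ h3
      simp [hθ] at h5
    have h6 := Tdual_finrank_succ X θ _ F' hXL'
    rw [← hW] at h6
    have h7 : ((WLF L F).map (Tdual X θ)).map (Tdual X θ) = WLF L F := by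
      rw [← Submodule.map_comp]
      have : Tdual X θ ∘ₗ Tdual X θ = LinearMap.id := LinearMap.ext (Tdual_invol X θ hθ)
      rw [this, Submodule.map_id]
    rw [h7, WLF_fst] at h6
    omega
end
end

section
/- Every maximally isotropic subspace W ⊆ V ⊕ V* is of the form W_{L,F}: letting L ⊆ V be the image of W under the projection V ⊕ V* → V, one has W ∩ ({0} ⊕ V*) = Ann L, and there exists an alternating linear map F : V → V* with W = W_{L,F}; moreover L is uniquely determined by W, and F is determined by W up to its restriction to L (i.e. the bilinear form (x, y) ↦ F(x)(y) on L × L is unique). -/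
noncomputable section

variable {V : Type*} [AddCommGroup V] [Module ℝ V] [FiniteDimensional ℝ V]

theorem mem_WLF_iff (L : Submodule ℝ V) (F : V →ₗ[ℝ] Module.Dual ℝ V)
    (x : V) (ξ : Module.Dual ℝ V) :
    (x, ξ) ∈ WLF L F ↔ x ∈ L ∧ ξ - F x ∈ L.dualAnnihilator := by
  unfold WLF
  rw [Submodule.mem_map]
  constructor
  · rintro ⟨⟨y, η⟩, ⟨hy, hη⟩, h⟩
    replace h : (y, F y + η) = (x, ξ) := h
    rw [Prod.mk.injEq] at h
    obtain ⟨rfl, rfl⟩ := h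
    refine ⟨hy, ?_⟩
    rw [add_sub_cancel_left]
    exact hη
  · rintro ⟨hx, hξ⟩
    exact ⟨(x, ξ - F x), ⟨hx, hξ⟩, by simp [shear]⟩

theorem finrank_fst_aux {V D : Type*} [AddCommGroup V] [Module ℝ V] [FiniteDimensional ℝ V]
    [AddCommGroup D] [Module ℝ D] [FiniteDimensional ℝ D] (W : Submodule ℝ (V × D)) :
    Module.finrank ℝ (W.map (LinearMap.fst ℝ V D)) +
      Module.finrank ℝ (W.comap (LinearMap.inr ℝ V D)) = Module.finrank ℝ W := by
  have h2 : ∀ f : W →ₗ[ℝ] V, Module.finrank ℝ (LinearMap.range f) +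
      Module.finrank ℝ (LinearMap.ker f) = Module.finrank ℝ W :=
    fun f => LinearMap.finrank_range_add_finrank_ker f
  replace h2 := h2 ((LinearMap.fst ℝ V D).comp W.subtype)
  rw [LinearMap.range_comp, Submodule.range_subtype] at h2
  have h3 : (LinearMap.ker ((LinearMap.fst ℝ V D).comp W.subtype)).map W.subtype
      = (W.comap (LinearMap.inr ℝ V D)).map
        (LinearMap.inr ℝ V D) := by
    ext ⟨x, ξ⟩
    simp only [Submodule.mem_map, Submodule.mem_comap, LinearMap.mem_ker]
    constructor
    · rintro ⟨⟨⟨y, η⟩, hy⟩, h0, h⟩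
      simp at h0 h
      obtain ⟨rfl, rfl⟩ := h
      subst h0
      exact ⟨η, hy, rfl⟩
    · rintro ⟨η, hη, h⟩
      exact ⟨⟨_, hη⟩, by simp, h⟩
  have h4 := (Submodule.equivMapOfInjective W.subtype W.injective_subtype
    (LinearMap.ker ((LinearMap.fst ℝ V D).comp W.subtype))).finrank_eq
  have h5 := (Submodule.equivMapOfInjective (LinearMap.inr ℝ V D)
    LinearMap.inr_injective (W.comap (LinearMap.inr ℝ V D))).finrank_eq
  rw [h3] at h4
  omega

theorem zero_mem_iff_aux (W : Submodule ℝ (V × Module.Dual ℝ V)) (hW : MaxIsotropic W) :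
    W.comap (LinearMap.inr ℝ V (Module.Dual ℝ V)) =
      (W.map (LinearMap.fst ℝ V (Module.Dual ℝ V))).dualAnnihilator := by
  obtain ⟨hd, hq⟩ := hW
  apply Submodule.eq_of_le_of_finrank_eq
  · intro ξ hξ
    rw [Submodule.mem_dualAnnihilator]
    rintro _ ⟨⟨y, η⟩, hy, rfl⟩
    have := hq _ hξ _ hy
    simpa [gq] using this
  · have h1 := Subspace.finrank_add_finrank_dualAnnihilator_eq
      (W.map (LinearMap.fst ℝ V (Module.Dual ℝ V)))
    have h2 := finrank_fst_aux W
    omega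

/-- Every maximally isotropic subspace `W ⊆ V ⊕ V*` is of the form `W_{L,F}`:
with `L` the image of `W` under the projection to `V`, one has `W ∩ ({0} ⊕ V*) = Ann L` and
there is an alternating `F : V → V*` with `W = W_{L,F}`; moreover `L` is uniquely determined
by `W` and `F` is determined up to its restriction to `L`. -/
theorem maxIsotropic_eq_WLF (W : Submodule ℝ (V × Module.Dual ℝ V)) (hW : MaxIsotropic W) :
    let L := W.map (LinearMap.fst ℝ V (Module.Dual ℝ V))
    (∀ ξ : Module.Dual ℝ V, ((0 : V), ξ) ∈ W ↔ ξ ∈ L.dualAnnihilator) ∧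
    ∃ F : V →ₗ[ℝ] Module.Dual ℝ V, IsAltMap F ∧ W = WLF L F ∧
      ∀ (L' : Submodule ℝ V) (F' : V →ₗ[ℝ] Module.Dual ℝ V), IsAltMap F' → W = WLF L' F' →
        L' = L ∧ ∀ x ∈ L, ∀ y ∈ L, F' x y = F x y := by
  intro L
  have hA : ∀ ξ : Module.Dual ℝ V, ((0 : V), ξ) ∈ W ↔ ξ ∈ L.dualAnnihilator := by
    intro ξ
    rw [← zero_mem_iff_aux W hW]
    rfl
  refine ⟨hA, ?_⟩
  obtain ⟨P, hP⟩ := LinearMap.exists_leftInverse_of_injective L.subtype L.ker_subtype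
  have hP' : ∀ y (hy : y ∈ L), P y = ⟨y, hy⟩ := fun y hy => LinearMap.congr_fun hP ⟨y, hy⟩
  obtain ⟨s, hs⟩ : ∃ s : L →ₗ[ℝ] W, ∀ x : L, (s x).1.1 = x.1 := by
    let f : W →ₗ[ℝ] L := ((LinearMap.fst ℝ V (Module.Dual ℝ V)).comp W.subtype).codRestrict L
      (fun w => ⟨w.1, w.2, rfl⟩)
    have hf : LinearMap.range f = ⊤ := by
      rw [LinearMap.range_eq_top]
      rintro ⟨_, ⟨w, hw, rfl⟩⟩
      exact ⟨⟨w, hw⟩, rfl⟩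
    obtain ⟨s, hs⟩ := f.exists_rightInverse_of_surjective hf
    exact ⟨s, fun x => congrArg Subtype.val (LinearMap.congr_fun hs x)⟩
  let σ : L →ₗ[ℝ] Module.Dual ℝ V :=
    (LinearMap.snd ℝ V (Module.Dual ℝ V)).comp (W.subtype.comp s)
  have hσ : ∀ x : L, (x.1, σ x) ∈ W := by
    intro x
    have h : (x.1, σ x) = (s x).1 := Prod.ext (hs x).symm rfl
    rw [h]
    exact (s x).2
  let F : V →ₗ[ℝ] Module.Dual ℝ V :=
    ((L.subtype.comp P).dualMap).comp (σ.comp P)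
  have hF : ∀ x y, F x y = σ (P x) (P y).1 := fun x y => rfl
  have hFσ : ∀ x : L, F x.1 - σ x ∈ L.dualAnnihilator := by
    intro x
    rw [Submodule.mem_dualAnnihilator]
    intro y hy
    rw [LinearMap.sub_apply, hF, hP' y hy, hP' x.1 x.2, sub_self]
  have hWF : W = WLF L F := by
    ext ⟨x, ξ⟩
    rw [mem_WLF_iff]
    constructor
    · intro h
      have hx : x ∈ L := ⟨_, h, rfl⟩
      refine ⟨hx, ?_⟩
      have h1 := W.sub_mem h (hσ ⟨x, hx⟩)
      rw [Prod.mk_sub_mk, sub_self, hA] at h1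
      have h2 := L.dualAnnihilator.sub_mem h1 (hFσ ⟨x, hx⟩)
      simpa using h2
    · rintro ⟨hx, h⟩
      have h1 := L.dualAnnihilator.add_mem h (hFσ ⟨x, hx⟩)
      rw [← hA] at h1
      have h2 := W.add_mem h1 (hσ ⟨x, hx⟩)
      simpa using h2
  refine ⟨F, ?_, hWF, ?_⟩
  · intro x
    have := hW.2 _ (hσ (P x)) _ (hσ (P x))
    rw [hF]
    simp only [gq] at this
    linarith
  · intro L' F' _ h'
    have hL : L' = L := by
      ext x
      constructor
      · intro hx
        refine ⟨(x, F' x), ?_, rfl⟩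
        rw [h']
        exact (mem_WLF_iff _ _ _ _).2 ⟨hx, by simp⟩
      · rintro ⟨⟨y, η⟩, hy, rfl⟩
        rw [h'] at hy
        exact ((mem_WLF_iff _ _ _ _).1 hy).1
    refine ⟨hL, ?_⟩
    intro x hx y hy
    have h1 : (x, F' x) ∈ W := by
      rw [h']
      exact (mem_WLF_iff _ _ _ _).2 ⟨hL ▸ hx, by simp⟩
    rw [hWF] at h1
    have h2 := ((mem_WLF_iff _ _ _ _).1 h1).2
    rw [Submodule.mem_dualAnnihilator] at h2
    exact sub_eq_zero.1 (h2 y hy)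
end
end

section
/- Let g : V → V* be positive definite and B : V → V* alternating. Then V⁺ = {x ⊕ (g + B)(x) : x ∈ V} is an n-dimensional subspace of V ⊕ V* on which q is positive definite. Conversely, if V⁺ ⊆ V ⊕ V* is any n-dimensional subspace on which q is positive definite, then there exist a unique positive definite g : V → V* and a unique alternating B : V → V* such that V⁺ = {x ⊕ (g + B)(x) : x ∈ V}. (A generalised Riemannian metric on V ⊕ V* is thus exactly the datum of an ordinary metric g and a 2-form B.) -/
noncomputable section

variable {V : Type*} [AddCommGroup V] [Module ℝ V] [FiniteDimensional ℝ V]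

/-- A linear map `P : V → V*` is symmetric if `P(x)(y) = P(y)(x)` for all `x, y`. -/
def IsSymmMap (P : V →ₗ[ℝ] Module.Dual ℝ V) : Prop := ∀ x y, P x y = P y x

/-- A linear map `P : V → V*` is positive definite if it is symmetric and `P(x)(x) > 0` for all
`x ≠ 0`. -/
def IsPosDefMap (P : V →ₗ[ℝ] Module.Dual ℝ V) : Prop :=
  IsSymmMap P ∧ ∀ x : V, x ≠ 0 → 0 < P x x

/-- The graph `{x ⊕ P(x) : x ∈ V} ⊆ V ⊕ V*` of a linear map `P : V → V*`. -/
def graphSub (P : V →ₗ[ℝ] Module.Dual ℝ V) : Submodule ℝ (V × Module.Dual ℝ V) :=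
  LinearMap.range (LinearMap.prod LinearMap.id P)

/-- For `g : V → V*` positive definite and `B : V → V*` alternating, the graph
`V⁺ = {x ⊕ (g + B)(x)}` is an `n`-dimensional subspace of `V ⊕ V*` on which `q` is positive
definite; conversely, every `n`-dimensional subspace of `V ⊕ V*` on which `q` is positive
definite is such a graph for a unique positive definite `g` and a unique alternating `B`. -/
theorem generalised_metric_iff (g B : V →ₗ[ℝ] Module.Dual ℝ V)
    (hg : IsPosDefMap g) (hB : IsAltMap B) :
    (Module.finrank ℝ (graphSub (g + B)) = Module.finrank ℝ V ∧
      ∀ p ∈ graphSub (g + B), p ≠ 0 → 0 < gq p p) ∧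
    (∀ W : Submodule ℝ (V × Module.Dual ℝ V),
      Module.finrank ℝ W = Module.finrank ℝ V → (∀ p ∈ W, p ≠ 0 → 0 < gq p p) →
      ∃ (g' B' : V →ₗ[ℝ] Module.Dual ℝ V), IsPosDefMap g' ∧ IsAltMap B' ∧
        W = graphSub (g' + B') ∧
        ∀ (g'' B'' : V →ₗ[ℝ] Module.Dual ℝ V), IsPosDefMap g'' → IsAltMap B'' →
          W = graphSub (g'' + B'') → g'' = g' ∧ B'' = B') := by
  have mem : ∀ (P : V →ₗ[ℝ] Module.Dual ℝ V) (p : V × Module.Dual ℝ V),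
      p ∈ graphSub P ↔ p.2 = P p.1 := by
    intro P p
    unfold graphSub
    rw [LinearMap.mem_range]
    constructor
    · rintro ⟨x, rfl⟩
      rfl
    · intro h
      exact ⟨p.1, Prod.ext rfl h.symm⟩
  refine ⟨⟨?_, ?_⟩, ?_⟩
  · unfold graphSub
    apply LinearMap.finrank_range_of_inj
    intro x y h
    exact congrArg Prod.fst h
  · intro p hp hp0
    rw [mem] at hp
    have h1 : p.1 ≠ 0 := by
      intro h
      apply hp0
      rw [h, map_zero] at hp
      exact Prod.ext h hp
    have h2 := hg.2 p.1 h1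
    have h3 := hB p.1
    simp only [gq, hp, LinearMap.add_apply, h3]
    linarith
  · intro W hW hpos
    let f : W →ₗ[ℝ] V := (LinearMap.fst ℝ V (Module.Dual ℝ V)) ∘ₗ W.subtype
    have hf : Function.Injective f := by
      intro a b hab
      have hw1 : a.1.1 = b.1.1 := hab
      by_contra hne
      have h := hpos (a.1 - b.1) (W.sub_mem a.2 b.2)
        (fun h => hne (Subtype.ext (sub_eq_zero.1 h)))
      simp [gq, hw1] at h
    have hsurj : Function.Surjective f := by
      rw [← LinearMap.range_eq_top]
      apply Submodule.eq_top_of_finrank_eq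
      rw [← hW]
      exact LinearMap.finrank_range_of_inj hf
    let e : W ≃ₗ[ℝ] V := LinearEquiv.ofBijective f ⟨hf, hsurj⟩
    have he : ∀ w, e w = (w : V × Module.Dual ℝ V).1 := fun w => rfl
    let P : V →ₗ[ℝ] Module.Dual ℝ V :=
      (LinearMap.snd ℝ V (Module.Dual ℝ V)) ∘ₗ W.subtype ∘ₗ e.symm.toLinearMap
    have hP : ∀ x, P x = (e.symm x : V × Module.Dual ℝ V).2 := fun x => rfl
    have hx1 : ∀ x, (e.symm x : V × Module.Dual ℝ V).1 = x := fun x => by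
      rw [← he, LinearEquiv.apply_symm_apply]
    have hWP : W = graphSub P := by
      ext p
      rw [mem]
      constructor
      · intro hp
        have : e.symm p.1 = ⟨p, hp⟩ := by
          rw [LinearEquiv.symm_apply_eq, he]
        rw [hP, this]
      · intro hp
        have : p = e.symm p.1 := Prod.ext (hx1 p.1).symm hp
        rw [this]
        exact (e.symm p.1).2
    have hsum : (1/2 : ℝ) • (P + P.flip) + (1/2 : ℝ) • (P - P.flip) = P := by
      module
    refine ⟨(1/2 : ℝ) • (P + P.flip), (1/2 : ℝ) • (P - P.flip), ⟨?_, ?_⟩, ?_, ?_, ?_⟩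
    · intro x y
      simp only [LinearMap.smul_apply, LinearMap.add_apply, LinearMap.flip_apply, smul_eq_mul]
      ring
    · intro x hx
      have h := hpos (x, P x) (by rw [hWP, mem]) (fun h => hx (congrArg Prod.fst h))
      simp only [gq] at h
      simp only [LinearMap.smul_apply, LinearMap.add_apply, LinearMap.flip_apply, smul_eq_mul]
      linarith
    · intro x
      simp only [LinearMap.smul_apply, LinearMap.sub_apply, LinearMap.flip_apply, smul_eq_mul]
      ring
    · rw [hsum]
      exact hWP
    · intro g'' B'' hg'' hB'' hW''
      have hPe : P = g'' + B'' := by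
        refine LinearMap.ext fun x => ?_
        have h : (x, P x) ∈ W := by rw [hWP, mem]
        rw [hW'', mem] at h
        exact h
      have hskew : ∀ x y, B'' x y = - B'' y x := by
        intro x y
        have h := hB'' (x + y)
        have h1 := hB'' x
        have h2 := hB'' y
        simp only [map_add, LinearMap.add_apply] at h
        linarith
      constructor
      · ext x y
        have h1 := hg''.1 x y
        have h2 := hskew x y
        simp only [hPe, LinearMap.smul_apply, LinearMap.add_apply, LinearMap.flip_apply,
          smul_eq_mul]
        linarith
      · ext x y
        have h1 := hg''.1 x y
        have h2 := hskew x y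
        simp only [hPe, LinearMap.smul_apply, LinearMap.add_apply, LinearMap.sub_apply,
          LinearMap.flip_apply, smul_eq_mul]
        linarith
end
end

section
/- Let g : V → V* be positive definite and B : V → V* alternating, and set V⁺ = {x ⊕ (g + B)(x) : x ∈ V} and V⁻ = {x ⊕ (−g + B)(x) : x ∈ V}. Then V ⊕ V* is the internal direct sum V⁺ ⊕ V⁻, the two summands are q-orthogonal (q(w⁺, w⁻) = 0 for w⁺ ∈ V⁺, w⁻ ∈ V⁻), q is positive definite on V⁺ and negative definite on V⁻ (a metric splitting). -/
noncomputable section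

variable {V : Type*} [AddCommGroup V] [Module ℝ V] [FiniteDimensional ℝ V]

/-- For `g : V → V*` positive definite and `B : V → V*` alternating, the graphs
`V⁺ = {x ⊕ (g + B)(x)}` and `V⁻ = {x ⊕ (−g + B)(x)}` give an internal direct sum decomposition
`V ⊕ V* = V⁺ ⊕ V⁻` into `q`-orthogonal subspaces on which `q` is positive, respectively
negative, definite (a metric splitting). -/
theorem metric_splitting (g B : V →ₗ[ℝ] Module.Dual ℝ V)
    (hg : IsPosDefMap g) (hB : IsAltMap B) :
    graphSub (g + B) ⊔ graphSub (-g + B) = ⊤ ∧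
    graphSub (g + B) ⊓ graphSub (-g + B) = ⊥ ∧
    (∀ p ∈ graphSub (g + B), ∀ p' ∈ graphSub (-g + B), gq p p' = 0) ∧
    (∀ p ∈ graphSub (g + B), p ≠ 0 → 0 < gq p p) ∧
    (∀ p ∈ graphSub (-g + B), p ≠ 0 → gq p p < 0) := by
  obtain ⟨hs, hp⟩ := hg
  have hBs : ∀ x y, B x y + B y x = 0 := by
    intro x y
    have h := hB (x + y)
    have h1 := hB x
    have h2 := hB y
    simp only [map_add, LinearMap.add_apply] at h
    linarith
  have hinj : Function.Injective g := by
    rw [injective_iff_map_eq_zero]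
    intro x hx
    by_contra hne
    have h := hp x hne
    rw [hx] at h
    simp at h
  have hsurj : Function.Surjective g :=
    (LinearMap.injective_iff_surjective_of_finrank_eq_finrank
      (Subspace.dual_finrank_eq (K := ℝ) (V := V)).symm).1 hinj
  refine ⟨?_, ?_, ?_, ?_, ?_⟩
  · rw [eq_top_iff]
    rintro ⟨x, ξ⟩ -
    obtain ⟨w, hw⟩ := hsurj (ξ - B x)
    have hξ : ξ = g w + B x := by rw [hw]; abel
    rw [Submodule.mem_sup]
    refine ⟨_, ⟨(1 / 2 : ℝ) • (x + w), rfl⟩, _, ⟨(1 / 2 : ℝ) • (x - w), rfl⟩, ?_⟩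
    subst hξ
    ext1
    · simp
      module
    · simp
      module
  · rw [eq_bot_iff]
    rintro p ⟨⟨x, rfl⟩, ⟨y, hy⟩⟩
    have h1 : y = x := congrArg Prod.fst hy
    subst h1
    have h2 : (-g + B) y = (g + B) y := congrArg Prod.snd hy
    have h3 := LinearMap.congr_fun h2 y
    simp only [LinearMap.add_apply, LinearMap.neg_apply] at h3
    have h4 : y = 0 := by
      by_contra hne
      have := hp y hne
      linarith
    subst h4
    simp
  · rintro _ ⟨x, rfl⟩ _ ⟨y, rfl⟩
    have h1 := hs x y
    have h2 := hBs x y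
    simp [gq]
    linarith
  · rintro _ ⟨x, rfl⟩ hne
    have hx : x ≠ 0 := by
      rintro rfl
      simp at hne
    have h1 := hp x hx
    have h2 := hB x
    simp [gq]
    linarith
  · rintro _ ⟨x, rfl⟩ hne
    have hx : x ≠ 0 := by
      rintro rfl
      simp at hne
    have h1 := hp x hx
    have h2 := hB x
    simp [gq]
    linarith
end
end

section
/- Let g : V → V* be positive definite and B : V → V* alternating, with V⁺ = {x ⊕ (g + B)(x)} and V⁻ = {x ⊕ (−g + B)(x)}. If W ⊆ V ⊕ V* is maximally isotropic, then W ∩ V⁺ = 0 and W ∩ V⁻ = 0, and there is a unique linear map P : V⁺ → V⁻ whose graph is W, i.e. W = {w + P(w) : w ∈ V⁺}; moreover P is bijective and is an anti-isometry: q(P(w), P(w)) = −q(w, w) for all w ∈ V⁺. -/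
noncomputable section

variable {V : Type*} [AddCommGroup V] [Module ℝ V] [FiniteDimensional ℝ V]

theorem aux_decomp_unique (g B : V →ₗ[ℝ] Module.Dual ℝ V) (hg : IsPosDefMap g) (a b a' b' : V)
    (h : ((a, (g + B) a) : V × Module.Dual ℝ V) + (b, (-g + B) b) =
      (a', (g + B) a') + (b', (-g + B) b')) : a = a' ∧ b = b' := by
  have hinj : ∀ x, g x = 0 → x = 0 := by
    intro x hx
    by_contra h0
    have := hg.2 x h0
    simp [hx] at this
  have h1 : a + b = a' + b' := congrArg Prod.fst h
  have h2 : (g + B) a + (-g + B) b = (g + B) a' + (-g + B) b' := congrArg Prod.snd h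
  have hb : b = a' + b' - a := by rw [← h1]; abel
  have h3 : (2 : ℝ) • (a - a') = 0 := by
    apply hinj
    subst hb
    simp only [LinearMap.add_apply, LinearMap.neg_apply, map_sub, map_add] at h2
    rw [map_smul, map_sub, two_smul, ← sub_eq_zero.mpr h2]
    abel
  have h4 : a = a' := by
    rcases smul_eq_zero.mp h3 with h | h
    · norm_num at h
    · exact sub_eq_zero.mp h
  subst h4
  exact ⟨rfl, add_left_cancel h1⟩

theorem aux_gq (g B : V →ₗ[ℝ] Module.Dual ℝ V) (hg : IsPosDefMap g) (hB : IsAltMap B) (a b : V) :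
    gq (((a, (g + B) a) : V × Module.Dual ℝ V) + (b, (-g + B) b))
      (((a, (g + B) a) : V × Module.Dual ℝ V) + (b, (-g + B) b)) = g a a - g b b := by
  have h1 := hB (a + b)
  have h2 := hg.1 a b
  have h3 := hB a
  have h4 := hB b
  simp only [gq, Prod.mk_add_mk, LinearMap.add_apply, LinearMap.neg_apply, map_add] at *
  linarith

theorem aux_surj (g B : V →ₗ[ℝ] Module.Dual ℝ V) (hg : IsPosDefMap g) :
    Function.Bijective ((LinearMap.prod LinearMap.id (g + B)).coprod
      (LinearMap.prod LinearMap.id (-g + B)) : V × V →ₗ[ℝ] V × Module.Dual ℝ V) := by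
  set T := ((LinearMap.prod LinearMap.id (g + B)).coprod
      (LinearMap.prod LinearMap.id (-g + B)) : V × V →ₗ[ℝ] V × Module.Dual ℝ V)
  have hi : Function.Injective T := by
    rintro ⟨a, b⟩ ⟨a', b'⟩ h
    obtain ⟨h1, h2⟩ := aux_decomp_unique g B hg a b a' b' h
    rw [h1, h2]
  refine ⟨hi, ?_⟩
  refine (LinearMap.injective_iff_surjective_of_finrank_eq_finrank ?_).mp hi
  simp [Subspace.dual_finrank_eq]

/-- Let `V⁺`, `V⁻` be the metric splitting attached to a positive definite
`g` and an alternating `B`.  Every maximally isotropic `W ⊆ V ⊕ V*` meets `V⁺` and `V⁻`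
trivially and is the graph of a unique linear map `P : V⁺ → V⁻`; moreover `P` is bijective and
is an anti-isometry: `q(P w, P w) = −q(w, w)`. -/
theorem maxIsotropic_graph_of_antiIsometry (g B : V →ₗ[ℝ] Module.Dual ℝ V)
    (hg : IsPosDefMap g) (hB : IsAltMap B)
    (W : Submodule ℝ (V × Module.Dual ℝ V)) (hW : MaxIsotropic W) :
    W ⊓ graphSub (g + B) = ⊥ ∧
    W ⊓ graphSub (-g + B) = ⊥ ∧
    ∃ P : graphSub (g + B) →ₗ[ℝ] graphSub (-g + B),
      (∀ p : V × Module.Dual ℝ V, p ∈ W ↔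
        ∃ w : graphSub (g + B), p = (w : V × Module.Dual ℝ V) + (P w : V × Module.Dual ℝ V)) ∧
      Function.Bijective P ∧
      (∀ w : graphSub (g + B),
        gq (P w : V × Module.Dual ℝ V) (P w : V × Module.Dual ℝ V) =
          -gq (w : V × Module.Dual ℝ V) (w : V × Module.Dual ℝ V)) ∧
      (∀ P' : graphSub (g + B) →ₗ[ℝ] graphSub (-g + B),
        (∀ p : V × Module.Dual ℝ V, p ∈ W ↔
          ∃ w : graphSub (g + B),
            p = (w : V × Module.Dual ℝ V) + (P' w : V × Module.Dual ℝ V)) → P' = P) := by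
  have hpos : ∀ x, g x x = 0 → x = 0 := by
    intro x hx
    by_contra h0
    exact (hg.2 x h0).ne' hx
  let T := LinearEquiv.ofBijective _ (aux_surj g B hg)
  have hT : ∀ a b, T (a, b) = ((a, (g + B) a) : V × Module.Dual ℝ V) + (b, (-g + B) b) :=
    fun a b => rfl
  have key : ∀ a b, T (a, b) ∈ W → g a a = g b b := by
    intro a b h
    have := hW.2 _ h _ h
    rw [hT, aux_gq g B hg hB] at this
    linarith
  let S : W →ₗ[ℝ] V × V := T.symm.toLinearMap ∘ₗ W.subtype
  have hS : ∀ w : W, T (S w) = w := fun w => T.apply_symm_apply _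
  have hSk : ∀ w : W, g (S w).1 (S w).1 = g (S w).2 (S w).2 := by
    intro w
    apply key
    have := w.2
    rwa [← hS w] at this
  have hS0 : ∀ w : W, (S w).1 = 0 → (S w).2 = 0 → w = 0 := by
    intro w h1 h2
    apply Subtype.ext
    rw [← hS w, show S w = 0 from Prod.ext h1 h2, map_zero]
    rfl
  let α : W →ₗ[ℝ] V := LinearMap.fst ℝ V V ∘ₗ S
  let β : W →ₗ[ℝ] V := LinearMap.snd ℝ V V ∘ₗ S
  have hα : Function.Injective α := by
    intro w₁ w₂ h12
    have hw : α (w₁ + (-1 : ℝ) • w₂) = 0 := by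
      rw [map_add, map_smul, h12, neg_one_smul, add_neg_cancel]
    suffices hz : w₁ + (-1 : ℝ) • w₂ = 0 by
      apply Subtype.ext
      have h0 : (w₁ : V × Module.Dual ℝ V) + (-1 : ℝ) • (w₂ : V × Module.Dual ℝ V) = 0 :=
        congrArg Subtype.val hz
      have ha : (w₁ : V × Module.Dual ℝ V).1 + (-1 : ℝ) • (w₂ : V × Module.Dual ℝ V).1 = 0 :=
        congrArg Prod.fst h0
      have hb : (w₁ : V × Module.Dual ℝ V).2 + (-1 : ℝ) • (w₂ : V × Module.Dual ℝ V).2 = 0 :=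
        congrArg Prod.snd h0
      rw [neg_one_smul, ← sub_eq_add_neg, sub_eq_zero] at ha
      refine Prod.ext ha (LinearMap.ext fun x => ?_)
      have hc : (w₁ : V × Module.Dual ℝ V).2 x + (-1 : ℝ) * (w₂ : V × Module.Dual ℝ V).2 x = 0 :=
        congrArg (fun F : Module.Dual ℝ V => F x) hb
      linarith
    generalize w₁ + (-1 : ℝ) • w₂ = w at hw ⊢
    have h1 : (S w).1 = 0 := hw
    refine hS0 w h1 (hpos _ ?_)
    rw [← hSk, h1]; simp
  have hβ : Function.Injective β := by
    intro w₁ w₂ h12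
    have hw : β (w₁ + (-1 : ℝ) • w₂) = 0 := by
      rw [map_add, map_smul, h12, neg_one_smul, add_neg_cancel]
    suffices hz : w₁ + (-1 : ℝ) • w₂ = 0 by
      apply Subtype.ext
      have h0 : (w₁ : V × Module.Dual ℝ V) + (-1 : ℝ) • (w₂ : V × Module.Dual ℝ V) = 0 :=
        congrArg Subtype.val hz
      have ha : (w₁ : V × Module.Dual ℝ V).1 + (-1 : ℝ) • (w₂ : V × Module.Dual ℝ V).1 = 0 :=
        congrArg Prod.fst h0
      have hb : (w₁ : V × Module.Dual ℝ V).2 + (-1 : ℝ) • (w₂ : V × Module.Dual ℝ V).2 = 0 :=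
        congrArg Prod.snd h0
      rw [neg_one_smul, ← sub_eq_add_neg, sub_eq_zero] at ha
      refine Prod.ext ha (LinearMap.ext fun x => ?_)
      have hc : (w₁ : V × Module.Dual ℝ V).2 x + (-1 : ℝ) * (w₂ : V × Module.Dual ℝ V).2 x = 0 :=
        congrArg (fun F : Module.Dual ℝ V => F x) hb
      linarith
    generalize w₁ + (-1 : ℝ) • w₂ = w at hw ⊢
    have h1 : (S w).2 = 0 := hw
    refine hS0 w (hpos _ ?_) h1
    rw [hSk, h1]; simp
  let eα : W ≃ₗ[ℝ] V := LinearEquiv.ofBijective α ⟨hα,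
    (LinearMap.injective_iff_surjective_of_finrank_eq_finrank (K := ℝ) (V := W) (V₂ := V) hW.1).mp hα⟩
  let eβ : W ≃ₗ[ℝ] V := LinearEquiv.ofBijective β ⟨hβ,
    (LinearMap.injective_iff_surjective_of_finrank_eq_finrank (K := ℝ) (V := W) (V₂ := V) hW.1).mp hβ⟩
  have jinj : ∀ F : V →ₗ[ℝ] Module.Dual ℝ V,
      Function.Injective (LinearMap.prod LinearMap.id F) := fun F x y h => congrArg Prod.fst h
  let j : ∀ F : V →ₗ[ℝ] Module.Dual ℝ V, V ≃ₗ[ℝ] graphSub F :=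
    fun F => LinearEquiv.ofInjective _ (jinj F)
  have hj : ∀ F x, (j F x : V × Module.Dual ℝ V) = (x, F x) := fun F x => rfl
  let P : graphSub (g + B) ≃ₗ[ℝ] graphSub (-g + B) :=
    (j (g + B)).symm ≪≫ₗ eα.symm ≪≫ₗ eβ ≪≫ₗ j (-g + B)
  have hP : ∀ w : W, P (j (g + B) (S w).1) = j (-g + B) (S w).2 := by
    intro w
    have : (S w).1 = eα w := rfl
    simp only [P, LinearEquiv.trans_apply, LinearEquiv.symm_apply_apply, this]
    rfl
  have hw : ∀ v : graphSub (g + B), ∃ w : W, v = j (g + B) (S w).1 := by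
    intro v
    refine ⟨eα.symm ((j (g + B)).symm v), ?_⟩
    have : (S (eα.symm ((j (g + B)).symm v))).1 = eα (eα.symm ((j (g + B)).symm v)) := rfl
    rw [this]; simp
  refine ⟨?_, ?_, P.toLinearMap, ?_, P.bijective, ?_, ?_⟩
  · rw [eq_bot_iff]
    rintro _ ⟨h, a, rfl⟩
    have e : T (a, 0) = LinearMap.prod LinearMap.id (g + B) a := by simp [hT]
    have h' := h
    rw [SetLike.mem_coe, ← e] at h'
    have := hpos a (by rw [key _ _ h']; simp)
    simp [this]
  · rw [eq_bot_iff]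
    rintro _ ⟨h, a, rfl⟩
    have e : T (0, a) = LinearMap.prod LinearMap.id (-g + B) a := by simp [hT]
    have h' := h
    rw [SetLike.mem_coe, ← e] at h'
    have := hpos a (by rw [← key _ _ h']; simp)
    simp [this]
  · intro p
    constructor
    · intro hp
      refine ⟨j (g + B) (S ⟨p, hp⟩).1, ?_⟩
      rw [LinearEquiv.coe_coe, hP, hj, hj]
      exact (hS ⟨p, hp⟩).symm
    · rintro ⟨v, rfl⟩
      obtain ⟨w, rfl⟩ := hw v
      rw [LinearEquiv.coe_coe, hP, hj, hj, ← hT]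
      have := w.2
      rwa [← hS w] at this
  · intro v
    obtain ⟨w, rfl⟩ := hw v
    rw [LinearEquiv.coe_coe, hP, hj, hj]
    have h1 := hSk w
    have h2 := hB (S w).1
    have h3 := hB (S w).2
    simp only [gq, LinearMap.add_apply, LinearMap.neg_apply]
    linarith
  · intro P' h
    ext1 v
    obtain ⟨b, hb⟩ := (j (-g + B)).surjective (P' v)
    obtain ⟨a, rfl⟩ := (j (g + B)).surjective v
    have hmem := (h _).mpr ⟨j (g + B) a, rfl⟩
    rw [← hb, hj, hj, ← hT] at hmem
    have hs : S ⟨_, hmem⟩ = (a, b) := T.symm_apply_apply _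
    have := hP ⟨_, hmem⟩
    rw [hs] at this
    rw [← hb, LinearEquiv.coe_coe, this]
end
end

section
/- Let g : V → V* be positive definite, B : V → V* alternating, L ⊆ V a subspace, F : V → V* alternating, and let W = W_{L,F} ⊆ V ⊕ V*. Let π± : V → V ⊕ V* be the maps π±(x) = x ⊕ (±g + B)(x) (linear isomorphisms onto V⁺ and V⁻ respectively), and let P : V⁺ → V⁻ be the unique linear map whose graph is W. Then the gluing matrix R = π₋^{-1} ∘ P ∘ π₊ : V → V satisfies: (i) R is g-orthogonal, g(R(x))(R(y)) = g(x)(y) for all x, y; (ii) R(x) = −x for every x in the g-orthogonal complement L^⊥ = {x ∈ V : g(x)(v) = 0 for all v ∈ L}; (iii) R(L) = L, and the unique endomorphism 𝔣 of L determined by g(𝔣(v))(w) = F(v)(w) − B(v)(w) for all v, w ∈ L satisfies R(v) + 𝔣(R(v)) = v − 𝔣(v) for all v ∈ L, i.e. R restricted to L is the Cayley transform (id + 𝔣)^{-1}(id − 𝔣). -/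
noncomputable section

variable {V : Type*} [AddCommGroup V] [Module ℝ V] [FiniteDimensional ℝ V]

theorem mem_WLF_aux (L : Submodule ℝ V) (F : V →ₗ[ℝ] Module.Dual ℝ V)
    (p : V × Module.Dual ℝ V) :
    p ∈ WLF L F ↔ p.1 ∈ L ∧ ∀ w ∈ L, p.2 w = F p.1 w := by
  unfold WLF shear
  constructor
  · rintro ⟨⟨x, ξ⟩, ⟨hx, hξ⟩, rfl⟩
    refine ⟨hx, fun w hw => ?_⟩
    have := (Submodule.mem_dualAnnihilator ξ).1 hξ w hw
    simp [this]
  · rintro ⟨h1, h2⟩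
    refine ⟨(p.1, p.2 - F p.1), ⟨h1, ?_⟩, ?_⟩
    · refine (Submodule.mem_dualAnnihilator _).2 fun w hw => ?_
      simp [h2 w hw]
    · ext <;> simp

theorem solve_aux (L : Submodule ℝ V) (C H : V →ₗ[ℝ] Module.Dual ℝ V)
    (hC : ∀ x : V, x ≠ 0 → 0 < C x x) :
    ∃ S : V →ₗ[ℝ] V, (∀ x, S x ∈ L) ∧ ∀ x, ∀ w ∈ L, C (S x) w = H x w := by
  let T : L →ₗ[ℝ] Module.Dual ℝ L := L.subtype.dualMap ∘ₗ C ∘ₗ L.subtype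
  have hT : Function.Injective T := by
    rw [injective_iff_map_eq_zero]
    intro a ha
    by_contra hne
    have h1 := hC a (by simpa using hne)
    have h2 : T a a = 0 := by rw [ha]; rfl
    have h3 : T a a = C a a := rfl
    linarith
  let e : L ≃ₗ[ℝ] Module.Dual ℝ L :=
    LinearEquiv.ofInjectiveOfFinrankEq T hT Subspace.dual_finrank_eq.symm
  refine ⟨L.subtype ∘ₗ e.symm.toLinearMap ∘ₗ L.subtype.dualMap ∘ₗ H, fun x => ?_, ?_⟩
  · exact (e.symm _).2
  · intro x w hw
    have h : T (e.symm (L.subtype.dualMap (H x))) = L.subtype.dualMap (H x) :=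
      e.apply_symm_apply _
    exact congrArg (fun φ : Module.Dual ℝ L => φ ⟨w, hw⟩) h

/-- The gluing matrix of a calibrated pair.  With `π±(x) = x ⊕ (±g + B)(x)`
(the isomorphisms of `V` onto `V⁺`, `V⁻`), the isotropic pair `(L, F)` determines a unique
`R : V → V` with `π₊(x) + π₋(R x) ∈ W_{L,F}` for all `x` (i.e. `R = π₋⁻¹ ∘ P ∘ π₊` for the
graph map `P : V⁺ → V⁻` of `W_{L,F}`); `R` is `g`-orthogonal, equals `−id` on the
`g`-orthogonal complement of `L`, preserves `L`, and on `L` it is the Cayley transform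
`(id + 𝔣)⁻¹ ∘ (id − 𝔣)` of the endomorphism `𝔣` of `L` determined by
`g(𝔣 v)(w) = F(v)(w) − B(v)(w)`. -/
theorem gluing_matrix (g B F : V →ₗ[ℝ] Module.Dual ℝ V)
    (hg : IsPosDefMap g) (hB : IsAltMap B) (hF : IsAltMap F) (L : Submodule ℝ V) :
    let πp : V →ₗ[ℝ] V × Module.Dual ℝ V := LinearMap.prod LinearMap.id (g + B)
    let πm : V →ₗ[ℝ] V × Module.Dual ℝ V := LinearMap.prod LinearMap.id (-g + B)
    ∃ R : V →ₗ[ℝ] V,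
      (∀ x : V, πp x + πm (R x) ∈ WLF L F) ∧
      (∀ R' : V →ₗ[ℝ] V, (∀ x : V, πp x + πm (R' x) ∈ WLF L F) → R' = R) ∧
      (∀ x y : V, g (R x) (R y) = g x y) ∧
      (∀ x : V, (∀ v ∈ L, g x v = 0) → R x = -x) ∧
      L.map R = L ∧
      (∃ f : V →ₗ[ℝ] V, (∀ v ∈ L, f v ∈ L) ∧
        ∀ v ∈ L, ∀ w ∈ L, g (f v) w = F v w - B v w) ∧
      (∀ f : V →ₗ[ℝ] V, (∀ v ∈ L, f v ∈ L) →
        (∀ v ∈ L, ∀ w ∈ L, g (f v) w = F v w - B v w) →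
        ∀ v ∈ L, R v + f (R v) = v - f v) := by
  intro πp πm
  obtain ⟨hs, hp⟩ := hg
  have anti : ∀ (A : V →ₗ[ℝ] Module.Dual ℝ V), IsAltMap A → ∀ x y, A x y = - A y x := by
    intro A hA x y
    have h := hA (x + y)
    have h1 := hA x
    have h2 := hA y
    simp only [map_add, LinearMap.add_apply] at h
    linarith
  obtain ⟨S, hSL, hS⟩ := solve_aux L (g + F - B) ((2 : ℝ) • g) (by
    intro x hx
    have := hp x hx
    have h1 := hF x
    have h2 := hB x
    simp only [LinearMap.add_apply, LinearMap.sub_apply]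
    linarith)
  simp only [LinearMap.add_apply, LinearMap.sub_apply, LinearMap.smul_apply, smul_eq_mul] at hS
  have uniq : ∀ x, ∀ u ∈ L, (∀ w ∈ L, g u w + F u w - B u w = 2 * g x w) → u = S x := by
    intro x u hu h
    by_contra hne
    have hd : u - S x ∈ L := L.sub_mem hu (hSL x)
    have h0 := hp (u - S x) (sub_ne_zero.2 hne)
    have h1 := h _ hd
    have h2 := hS x _ hd
    have h3 := hF (u - S x)
    have h4 := hB (u - S x)
    simp only [map_sub, LinearMap.sub_apply] at h0 h1 h2 h3 h4
    linarith
  have memiff : ∀ x y, πp x + πm y ∈ WLF L F ↔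
      x + y ∈ L ∧ ∀ w ∈ L, g x w + B x w + (- g y w + B y w) = F x w + F y w := by
    intro x y
    rw [mem_WLF_aux]
    simp [πp, πm]
  have orth : ∀ x y : V, g ((S - LinearMap.id : V →ₗ[ℝ] V) x) ((S - LinearMap.id : V →ₗ[ℝ] V) y) = g x y := by
    intro x y
    have h1 := hS x _ (hSL y)
    have h2 := hS y _ (hSL x)
    have h3 := anti F hF (S x) (S y)
    have h4 := anti B hB (S x) (S y)
    have h5 := hs (S x) (S y)
    have h6 := hs (S x) y
    simp only [LinearMap.sub_apply, LinearMap.id_apply, map_sub]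
    linarith
  refine ⟨S - LinearMap.id, ?_, ?_, orth, ?_, ?_, ?_, ?_⟩
  · intro x
    rw [memiff]
    refine ⟨by simpa using hSL x, fun w hw => ?_⟩
    have := hS x w hw
    simp only [LinearMap.sub_apply, LinearMap.id_apply, map_sub]
    linarith
  · intro R' hR'
    ext x
    obtain ⟨h1, h2⟩ := (memiff _ _).1 (hR' x)
    have := uniq x _ h1 (fun w hw => by
      have := h2 w hw
      simp only [LinearMap.add_apply, map_add]
      linarith)
    simp [← this]
  · intro x hx
    have := uniq x 0 L.zero_mem (fun w hw => by simp [hx w hw])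
    simp [← this]
  · have inj : Function.Injective (S - LinearMap.id : V →ₗ[ℝ] V) := by
      rw [injective_iff_map_eq_zero]
      intro a ha
      by_contra hne
      have h1 := orth a a
      have h2 := hp a hne
      rw [ha] at h1
      simp at h1
      linarith
    refine Submodule.eq_of_le_of_finrank_eq ?_ (LinearEquiv.finrank_eq
      (Submodule.equivMapOfInjective _ inj L)).symm
    rintro _ ⟨x, hx, rfl⟩
    exact L.sub_mem (hSL x) hx
  · obtain ⟨f, hf, hf'⟩ := solve_aux L g (F - B) hp
    exact ⟨f, fun v _ => hf v, fun v _ w hw => by simpa using hf' v w hw⟩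
  · intro f hf hf' v hv
    simp only [LinearMap.sub_apply, LinearMap.id_apply, map_sub]
    rw [← sub_eq_zero]
    by_contra hne
    have h0 := hp _ hne
    have hd : S v - v + (f (S v) - f v) - (v - f v) ∈ L :=
      L.sub_mem (L.add_mem (L.sub_mem (hSL v) hv) (L.sub_mem (hf _ (hSL v)) (hf _ hv)))
        (L.sub_mem hv (hf _ hv))
    generalize hdd : S v - v + (f (S v) - f v) - (v - f v) = d at h0 hd
    have h1 := hS v d hd
    have h2 := hf' _ (hSL v) d hd
    have h3 : g d d = g (S v - v + (f (S v) - f v) - (v - f v)) d := by rw [hdd]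
    simp only [LinearMap.sub_apply, LinearMap.add_apply, map_sub, map_add] at h3
    linarith
end
end
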